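/- For all positive integers p, n and every m ≥ (p + 1)n − 1, the geometric realization of the multiple chessboard complex Δ_{m,n}^{p,1} (at most p rooks in each of the n rows and at most one rook in each of the m columns) is (pn − 2)-connected. -/

import Mathlib

open scoped BigOperators

/-- A face of the multiple chessboard complex `Δ_{m,n}^{p,q}`: at most `p` squares in
each row and at most `q` squares in each column. -/
def IsFace (m n : ℕ) (k : Fin n → ℕ) (l : Fin m → ℕ)
    (A : Finset (Fin m × Fin n)) : Prop :=
  (∀ i : Fin n, (A.filter fun v => v.2 = i).card ≤ k i) ∧
  (∀ j : Fin m, (A.filter fun v => v.1 = j).card ≤ l j)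

/-- The geometric realization of the multiple chessboard complex. -/
def Realization (m n : ℕ) (k : Fin n → ℕ) (l : Fin m → ℕ) :
    Set ((Fin m × Fin n) → ℝ) :=
  {f | (∀ v, 0 ≤ f v ∧ f v ≤ 1) ∧ ∑ v, f v = 1 ∧
      IsFace m n k l (Finset.univ.filter fun v => 0 < f v)}

/-- `c`-connectedness of a topological space, for `c : ℤ`. -/
def CConnected (c : ℤ) (X : Type) [TopologicalSpace X] : Prop :=
  Nonempty X ∧ (0 ≤ c → PathConnectedSpace X) ∧
  ∀ i : ℕ, 1 ≤ i → (i : ℤ) ≤ c → ∀ x : X, Subsingleton (HomotopyGroup (Fin i) X x)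

open Set Topology

/-- A set `Y` of points having, for some fixed finite set `T` of reals, fewer than `d`
coordinates outside `T`; such a `Y` has topological dimension less than `d`. -/
def HasGridDimLT {N : ℕ} (d : ℕ) (Y : Set (Fin N → ℝ)) : Prop :=
  ∃ T : Finset ℝ, ∀ x ∈ Y, (Finset.univ.filter fun i => x i ∉ T).card < d

/-- `X` has the extension property for maps out of closed subsets of compact sets of grid
dimension less than `d`. -/
def ExtendsBelow {V : Type*} (d : ℕ) (X : Set (V → ℝ)) : Prop :=
  ∀ (N : ℕ) (Y Q : Set (Fin N → ℝ)) (f : (Fin N → ℝ) → V → ℝ), IsCompact Y → HasGridDimLT d Y →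
    Q ⊆ Y → IsClosed Q → ContinuousOn f Q → MapsTo f Q X →
    ∃ g : (Fin N → ℝ) → V → ℝ, ContinuousOn g Y ∧ MapsTo g Y X ∧ EqOn g f Q

theorem HasGridDimLT.mono {N d : ℕ} {Y Z : Set (Fin N → ℝ)} (h : HasGridDimLT d Y) (hZ : Z ⊆ Y) :
    HasGridDimLT d Z :=
  h.imp fun _ hT x hx => hT x (hZ hx)

theorem hasGridDimLT_of_lt {N d : ℕ} (h : N < d) (Y : Set (Fin N → ℝ)) : HasGridDimLT d Y :=
  ⟨∅, fun x _ => (Finset.card_le_univ _).trans_lt (by simpa using h)⟩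

theorem extendsBelow_zero {V : Type*} (X : Set (V → ℝ)) : ExtendsBelow 0 X := by
  rintro N Y Q f - ⟨T, hT⟩ - - - -
  have hY : Y = ∅ := eq_empty_of_forall_notMem fun x hx => by simpa using hT x hx
  by_cases hQ : Q = ∅
  · exact ⟨f, by simp [hY], by simp [hY, MapsTo], by simp [hQ]⟩
  · exact ⟨f, by simp [hY], by simp [hY, MapsTo], fun x _ => rfl⟩

/-- A compact set of grid dimension less than `d + 1` is split between two levels of a continuous
function along a closed set of grid dimension less than `d`. -/
theorem HasGridDimLT.exists_partition {N d : ℕ} {Y : Set (Fin N → ℝ)} (hY : IsCompact Y)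
    (hd : HasGridDimLT (d + 1) Y) {u : (Fin N → ℝ) → ℝ} (hu : Continuous u) {a b : ℝ}
    (hab : a < b) :
    ∃ P₀ P₁ : Set (Fin N → ℝ), IsClosed P₀ ∧ IsClosed P₁ ∧ P₀ ∪ P₁ = Y ∧ (∀ x ∈ P₀, u x < b) ∧
      (∀ x ∈ P₁, a < u x) ∧ HasGridDimLT d (P₀ ∩ P₁) := by
  classical
  obtain ⟨T, hT⟩ := hd
  have hK : IsCompact (Y ∩ {x | b ≤ u x}) :=
    hY.inter_right (isClosed_le continuous_const hu)
  have key : ∀ x ∈ Y ∩ {x | b ≤ u x}, ∃ r : ℝ, 0 < r ∧ Metric.closedBall x r ⊆ {y | a < u y} ∧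
      ∀ t ∈ T, ∀ i, |t - x i| ≠ r := by
    rintro x ⟨-, hx⟩
    have hopen : {y | a < u y} ∈ 𝓝 x := (isOpen_lt continuous_const hu).mem_nhds (hab.trans_le hx)
    obtain ⟨ε, hε, hball⟩ := Metric.nhds_basis_closedBall.mem_iff.1 hopen
    have hinf : (Ioo 0 ε \ ((T ×ˢ (Finset.univ : Finset (Fin N))).image
        fun q : ℝ × Fin N => |q.1 - x q.2| : Finset ℝ)).Nonempty :=
      ((Ioo_infinite hε).sdiff (Finset.finite_toSet _)).nonempty
    obtain ⟨r, ⟨hr0, hrε⟩, hr⟩ := hinf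
    refine ⟨r, hr0, (Metric.closedBall_subset_closedBall hrε.le).trans hball, ?_⟩
    intro t ht i hti
    exact hr (by
      simp only [Finset.coe_image, mem_image, Finset.mem_coe, Finset.mem_product]
      exact ⟨(t, i), ⟨ht, Finset.mem_univ _⟩, hti⟩)
  choose! r hr0 hra hrT using key
  obtain ⟨s, hsK, hs⟩ := hK.elim_nhds_subcover (fun x => Metric.ball x (r x))
    fun x hx => Metric.ball_mem_nhds x (hr0 x hx)
  refine ⟨Y \ ⋃ x ∈ s, Metric.ball x (r x), Y ∩ ⋃ x ∈ s, Metric.closedBall x (r x),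
    ?_, ?_, ?_, ?_, ?_, ?_⟩
  · exact hY.isClosed.sdiff (isOpen_biUnion fun x _ => Metric.isOpen_ball)
  · exact hY.isClosed.inter (s.finite_toSet.isClosed_biUnion fun x _ => Metric.isClosed_closedBall)
  · ext y
    simp only [mem_union, mem_sdiff, mem_inter_iff, mem_iUnion]
    constructor
    · tauto
    · intro hy
      by_cases h : ∃ x, ∃ (_ : x ∈ s), y ∈ Metric.ball x (r x)
      · obtain ⟨x, hx, hyx⟩ := h
        exact Or.inr ⟨hy, x, hx, Metric.ball_subset_closedBall hyx⟩
      · exact Or.inl ⟨hy, h⟩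
  · rintro y ⟨hy, hyn⟩
    by_contra hb
    exact hyn (hs ⟨hy, not_lt.1 hb⟩)
  · rintro y ⟨-, hy⟩
    simp only [mem_iUnion] at hy
    obtain ⟨x, hx, hyx⟩ := hy
    exact hra x (hsK x hx) hyx
  · refine ⟨T ∪ (s ×ˢ (Finset.univ : Finset (Fin N))).biUnion
      fun q => {q.1 q.2 + r q.1, q.1 q.2 - r q.1}, ?_⟩
    rintro y ⟨⟨hy, hyn⟩, -, hyc⟩
    simp only [mem_iUnion, not_exists] at hyc hyn
    obtain ⟨x, hx, hyx⟩ := hyc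
    have hnb := hyn x hx
    rw [Metric.mem_ball, dist_pi_lt_iff (hr0 x (hsK x hx))] at hnb
    push Not at hnb
    obtain ⟨i, hi⟩ := hnb
    have hdist : |y i - x i| = r x :=
      le_antisymm ((dist_le_pi_dist y x i).trans hyx) hi
    refine lt_of_lt_of_le (Finset.card_lt_card ?_) (Nat.lt_succ_iff.1 (hT y hy))
    refine Finset.ssubset_iff_of_subset ?_ |>.2 ⟨i, ?_, ?_⟩
    · intro j hj
      simp only [Finset.mem_filter, Finset.mem_univ, true_and, Finset.mem_union, not_or] at hj ⊢
      exact hj.1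
    · simp only [Finset.mem_filter, Finset.mem_univ, true_and]
      intro hiT
      exact hrT x (hsK x hx) _ hiT i hdist
    · simp only [Finset.mem_filter, Finset.mem_univ, true_and, not_not, Finset.mem_union,
        Finset.mem_biUnion, Finset.mem_product]
      refine Or.inr ⟨(x, i), ⟨hx, trivial⟩, ?_⟩
      simp only [Finset.mem_insert, Finset.mem_singleton]
      rcases abs_eq (hr0 x (hsK x hx)).le |>.1 hdist with h | h
      · left; linarith
      · right; linarith

/-- Maps agreeing on the intersection of two closed sets glue. -/
theorem exists_continuousOn_glue {α β : Type*} [TopologicalSpace α] [TopologicalSpace β]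
    {A B : Set α} (hA : IsClosed A) (hB : IsClosed B) {f g : α → β} (hf : ContinuousOn f A)
    (hg : ContinuousOn g B) (h : EqOn f g (A ∩ B)) :
    ∃ k : α → β, ContinuousOn k (A ∪ B) ∧ EqOn k f A ∧ EqOn k g B := by
  classical
  have h₁ : EqOn (A.piecewise f g) f A := piecewise_eqOn A f g
  have h₂ : EqOn (A.piecewise f g) g B := fun x hx => by
    by_cases hxA : x ∈ A
    · rw [h₁ hxA, h ⟨hxA, hx⟩]
    · exact piecewise_eq_of_notMem _ _ _ hxA
  exact ⟨A.piecewise f g, (hf.congr h₁).union_of_isClosed (hg.congr h₂) hA hB, h₁, h₂⟩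

theorem exists_continuous_extension {α V : Type*} [TopologicalSpace α] [NormalSpace α] {Q : Set α}
    (hQ : IsClosed Q) {f : α → V → ℝ} (hf : ContinuousOn f Q) :
    ∃ g : α → V → ℝ, Continuous g ∧ EqOn g f Q := by
  obtain ⟨g, hg⟩ := ContinuousMap.exists_restrict_eq hQ ⟨Q.domRestrict f, hf.domRestrict⟩
  exact ⟨g, g.continuous, fun x hx => congrArg (fun k => k ⟨x, hx⟩) hg⟩

theorem ExtendsBelow.pathConnectedSpace {V : Type} {d : ℕ} {X : Set (V → ℝ)}
    (h : ExtendsBelow d X) (hd : 2 ≤ d) (hX : Nonempty X) : PathConnectedSpace X := by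
  refine ⟨hX, fun x y => ?_⟩
  obtain ⟨g, hg, hgX, hgf⟩ := h 1 (Icc 0 1) {z | z 0 = 0 ∨ z 0 = 1}
    (fun z => (1 - z 0) • x.1 + z 0 • y.1) isCompact_Icc (hasGridDimLT_of_lt (by omega) _)
    (by
      intro z hz
      constructor <;> intro i <;> rw [Subsingleton.elim i 0] <;> rcases hz with hz | hz <;>
        simp [hz])
    ((isClosed_eq (continuous_apply 0) continuous_const).union
      (isClosed_eq (continuous_apply 0) continuous_const))
    (by fun_prop)
    (by rintro z (hz | hz) <;> simp [hz])
  have hc : ∀ t : unitInterval, (fun _ : Fin 1 => (t : ℝ)) ∈ Icc (0 : Fin 1 → ℝ) 1 := fun t =>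
    ⟨fun _ => t.2.1, fun _ => t.2.2⟩
  refine ⟨⟨⟨fun t => ⟨g fun _ => t, hgX (hc t)⟩, ?_⟩, ?_, ?_⟩⟩
  · exact Continuous.subtype_mk (hg.comp_continuous (by fun_prop) hc) _
  · apply Subtype.ext
    simpa using hgf (x := fun _ => ((0 : unitInterval) : ℝ)) (by simp)
  · apply Subtype.ext
    simpa using hgf (x := fun _ => ((1 : unitInterval) : ℝ)) (by simp)

theorem ExtendsBelow.subsingleton_homotopyGroup {V : Type} {d : ℕ} {X : Set (V → ℝ)}
    (h : ExtendsBelow d X) {i : ℕ} (hi : i + 2 ≤ d) (x : X) :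
    Subsingleton (HomotopyGroup (Fin i) X x) := by
  refine ⟨fun p q => ?_⟩
  induction p using Quotient.inductionOn with | _ p => ?_
  induction q using Quotient.inductionOn with | _ q => ?_
  refine Quotient.sound ?_
  let tail : (Fin (i + 1) → ℝ) → Fin i → unitInterval :=
    fun z j => projIcc 0 1 zero_le_one (z j.succ)
  have htail : Continuous tail := by
    refine continuous_pi fun j => continuous_projIcc.comp (continuous_apply _)
  have hp : Continuous fun z => (p (tail z) : V → ℝ) :=
    continuous_subtype_val.comp (p.1.continuous.comp htail)
  have hq : Continuous fun z => (q (tail z) : V → ℝ) :=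
    continuous_subtype_val.comp (q.1.continuous.comp htail)
  have hbd : ∀ z : Fin (i + 1) → ℝ, (∃ j : Fin i, z j.succ = 0 ∨ z j.succ = 1) →
      tail z ∈ Cube.boundary (Fin i) := by
    rintro z ⟨j, hj | hj⟩
    · exact ⟨j, Or.inl (by simp [tail, hj])⟩
    · exact ⟨j, Or.inr (by simp [tail, hj])⟩
  obtain ⟨g, hg, hgX, hgf⟩ := h (i + 1) (Icc 0 1)
    (Icc 0 1 ∩ ⋃ j : Fin (i + 1), {z | z j = 0 ∨ z j = 1})
    (fun z => (1 - z 0) • (p (tail z) : V → ℝ) + z 0 • (q (tail z) : V → ℝ)) isCompact_Icc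
    (hasGridDimLT_of_lt (by omega) _) inter_subset_left
    (isClosed_Icc.inter (isClosed_iUnion_of_finite fun j =>
      (isClosed_eq (continuous_apply j) continuous_const).union
        (isClosed_eq (continuous_apply j) continuous_const)))
    (by
      refine Continuous.continuousOn ?_
      exact ((continuous_const.sub (continuous_apply 0)).smul hp).add
        ((continuous_apply 0).smul hq))
    (by
      rintro z ⟨-, hz⟩
      obtain ⟨j, hj⟩ := mem_iUnion.1 hz
      induction j using Fin.cases with
      | zero => rcases hj with hj | hj <;> simp_all
      | succ j =>
        have hb := hbd z ⟨j, hj⟩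
        simp only [GenLoop.boundary p _ hb, GenLoop.boundary q _ hb, ← add_smul, sub_add_cancel, one_smul]
        exact x.2)
  have hc : ∀ z : unitInterval × (Fin i → unitInterval),
      (Fin.cons (z.1 : ℝ) fun j => (z.2 j : ℝ) : Fin (i + 1) → ℝ) ∈
        Icc (0 : Fin (i + 1) → ℝ) 1 := by
    intro z
    constructor <;> intro j <;> induction j using Fin.cases with
      | zero => simp [z.1.2.1, z.1.2.2]
      | succ j => simp [(z.2 j).2.1, (z.2 j).2.2]
  have hcc : Continuous fun z : unitInterval × (Fin i → unitInterval) =>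
      (Fin.cons (z.1 : ℝ) fun j => (z.2 j : ℝ) : Fin (i + 1) → ℝ) := by
    refine continuous_pi fun j => ?_
    induction j using Fin.cases with
    | zero => simpa using by fun_prop
    | succ j => simpa using by fun_prop
  have ht : ∀ (t : unitInterval) (y : Fin i → unitInterval),
      tail (Fin.cons (t : ℝ) fun j => (y j : ℝ)) = y := by
    intro t y
    funext j
    simp [tail]
  refine ⟨⟨⟨⟨fun z => ⟨_, hgX (hc z)⟩,
    Continuous.subtype_mk (hg.comp_continuous hcc hc) _⟩, ?_, ?_⟩, ?_⟩⟩
  · intro y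
    apply Subtype.ext
    refine (hgf ⟨hc (0, y), mem_iUnion.2 ⟨0, Or.inl (by simp)⟩⟩).trans ?_
    simp only [ht]
    simp
  · intro y
    apply Subtype.ext
    refine (hgf ⟨hc (1, y), mem_iUnion.2 ⟨0, Or.inr (by simp)⟩⟩).trans ?_
    simp only [ht]
    simp
  · rintro t y ⟨j, hj⟩
    apply Subtype.ext
    refine (hgf ⟨hc (t, y), mem_iUnion.2 ⟨j.succ, ?_⟩⟩).trans ?_
    · rcases hj with hj | hj
      · exact Or.inl (by simp [hj])
      · exact Or.inr (by simp [hj])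
    · have hb : y ∈ Cube.boundary (Fin i) := ⟨j, hj⟩
      simp only [ht, GenLoop.boundary p _ hb, GenLoop.boundary q _ hb, ← add_smul, sub_add_cancel, one_smul]
      exact congrArg Subtype.val (GenLoop.boundary p _ hb).symm

theorem ExtendsBelow.nonempty {V : Type*} {d : ℕ} {X : Set (V → ℝ)} (h : ExtendsBelow d X)
    (hd : 1 ≤ d) : X.Nonempty := by
  obtain ⟨g, -, hg, -⟩ := h 0 univ ∅ (fun _ _ => 0) isCompact_univ (hasGridDimLT_of_lt hd _)
    (by simp) isClosed_empty (by simp) (by simp [MapsTo])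
  exact ⟨g 0, hg (mem_univ _)⟩

theorem ExtendsBelow.cConnected {V : Type} {d : ℕ} {X : Set (V → ℝ)}
    (h : ExtendsBelow d X) (hd : 1 ≤ d) : CConnected ((d : ℤ) - 2) X :=
  have hX : Nonempty X := (h.nonempty hd).to_subtype
  ⟨hX, fun h2 => h.pathConnectedSpace (by omega) hX,
    fun _ _ hi x => h.subsingleton_homotopyGroup (by omega) x⟩

section Polyhedron

variable {V : Type*}

/-- The faces not containing `v`. -/
def deletion (K : Set (Finset V)) (v : V) : Set (Finset V) := {A | A ∈ K ∧ v ∉ A}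

theorem deletion_subset {K : Set (Finset V)} {v : V} : deletion K v ⊆ K := fun _ hA => hA.1

section

variable [DecidableEq V]

/-- The faces not containing `v` that remain faces after adding `v`. -/
def link (K : Set (Finset V)) (v : V) : Set (Finset V) := {A | v ∉ A ∧ insert v A ∈ K}

/-- The point dividing the segment from `g` to the vertex `v` in the ratio `u : 1 - u`. -/
def towards (v : V) (u : ℝ) (g : V → ℝ) : V → ℝ :=
  fun w => (1 - u) * g w + if w = v then u else 0

/-- The radial projection away from the vertex `v`. -/
noncomputable def awayFrom (v : V) (x : V → ℝ) : V → ℝ :=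
  fun w => if w = v then 0 else x w / (1 - x v)

theorem continuousOn_awayFrom (v : V) :
    ContinuousOn (awayFrom v) {x : V → ℝ | x v < 1} := by
  refine continuousOn_pi.2 fun w => ?_
  by_cases h : w = v
  · simpa [awayFrom, h] using continuousOn_const
  · simp only [awayFrom, h, if_false]
    exact ContinuousOn.div (by fun_prop) (by fun_prop) fun x hx => (sub_pos.2 hx).ne'

theorem towards_awayFrom {v : V} {x : V → ℝ} (hx : x v < 1) : towards v (x v) (awayFrom v x) = x := by
  funext w
  have : 1 - x v ≠ 0 := (sub_pos.2 hx).ne'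
  by_cases h : w = v
  · simp [towards, awayFrom, h]
  · simp only [towards, awayFrom, h, if_false]
    field_simp
    ring

end

variable [Fintype V]

/-- The geometric realization of a family of faces. -/
def polyhedron (K : Set (Finset V)) : Set (V → ℝ) :=
  {f | (∀ v, 0 ≤ f v) ∧ ∑ v, f v = 1 ∧ (Finset.univ.filter fun v => 0 < f v) ∈ K}

theorem apply_eq_zero_of_mem_polyhedron {L : Set (Finset V)} {v : V} (hL : ∀ A ∈ L, v ∉ A)
    {g : V → ℝ} (hg : g ∈ polyhedron L) : g v = 0 := by
  by_contra h
  exact hL _ hg.2.2 (by simpa using lt_of_le_of_ne (hg.1 v) (Ne.symm h))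

variable [DecidableEq V]

variable {K : Set (Finset V)} {v : V}

theorem sum_towards {u : ℝ} {g : V → ℝ} (hg : ∑ w, g w = 1) : ∑ w, towards v u g w = 1 := by
  simp [towards, Finset.sum_add_distrib, ← Finset.mul_sum, hg]

theorem awayFrom_mem {L : Set (Finset V)} {x : V → ℝ} (hx : x ∈ polyhedron K) (hv : x v < 1)
    (hL : (Finset.univ.filter fun w => 0 < x w).erase v ∈ L) : awayFrom v x ∈ polyhedron L := by
  have h1 : 0 < 1 - x v := sub_pos.2 hv
  refine ⟨fun w => ?_, ?_, ?_⟩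
  · unfold awayFrom
    split_ifs
    · exact le_rfl
    · exact div_nonneg (hx.1 w) h1.le
  · have : ∀ w, awayFrom v x w = (x w - if w = v then x v else 0) / (1 - x v) := by
      intro w
      by_cases h : w = v <;> simp [awayFrom, h]
    simp only [this, ← Finset.sum_div, Finset.sum_sub_distrib, hx.2.1, Finset.sum_ite_eq',
      Finset.mem_univ, if_true]
    exact div_self h1.ne'
  · convert hL using 1
    ext w
    rw [Finset.mem_filter_univ, Finset.mem_erase, Finset.mem_filter_univ]
    by_cases h : w = v
    · simp [awayFrom, h]
    · simp [awayFrom, h, h1]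

theorem awayFrom_mem_deletion (hK : IsLowerSet K) {x : V → ℝ} (hx : x ∈ polyhedron K)
    (hv : x v < 1) : awayFrom v x ∈ polyhedron (deletion K v) :=
  awayFrom_mem hx hv ⟨hK (Finset.erase_subset _ _) hx.2.2, Finset.notMem_erase _ _⟩

theorem awayFrom_mem_link {x : V → ℝ} (hx : x ∈ polyhedron K) (hv : x v < 1)
    (hv0 : 0 < x v) : awayFrom v x ∈ polyhedron (link K v) :=
  awayFrom_mem hx hv ⟨Finset.notMem_erase _ _, by
    rw [Finset.insert_erase (by simpa using hv0)]
    exact hx.2.2⟩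

theorem towards_mem (hK : IsLowerSet K) {g : V → ℝ} (hg : g ∈ polyhedron (link K v)) {u : ℝ}
    (hu : u ∈ Icc (0 : ℝ) 1) : towards v u g ∈ polyhedron K := by
  refine ⟨fun w => ?_, sum_towards hg.2.1, hK ?_ hg.2.2.2⟩
  · exact add_nonneg (mul_nonneg (sub_nonneg.2 hu.2) (hg.1 w)) (by split_ifs; exacts [hu.1, le_rfl])
  · intro w hw
    by_cases h : w = v
    · simp [h]
    · rw [Finset.mem_filter_univ] at hw
      simp only [towards, h, if_false, add_zero] at hw
      simpa [h] using pos_of_mul_pos_right hw (sub_nonneg.2 hu.2)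

/-- A continuous choice of level above which the coordinates of a point, together with `v`,
span a face. -/
theorem exists_level (hK : IsLowerSet K) (hv : {v} ∈ K) :
    ∃ t : (V → ℝ) → ℝ, Continuous t ∧ (∀ y, 0 ≤ t y) ∧
      (∀ y, insert v (Finset.univ.filter fun w => t y < y w) ∈ K) ∧
      ∀ y, insert v (Finset.univ.filter fun w => 0 < y w) ∈ K → t y = 0 := by
  classical
  let m : Finset V → (V → ℝ) → ℝ := fun σ y =>
    if h : σ.Nonempty ∧ insert v σ ∉ K then σ.inf' h.1 y else 0
  have hm : ∀ σ, Continuous (m σ) := by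
    intro σ
    by_cases h : σ.Nonempty ∧ insert v σ ∉ K
    · simp only [m, dif_pos h]
      exact Continuous.finset_inf'_apply _ fun w _ => continuous_apply w
    · simp only [m, dif_neg h]
      exact continuous_const
  have hne : (Finset.univ : Finset (Finset V)).Nonempty := ⟨∅, Finset.mem_univ _⟩
  have h0 : ∀ y, 0 ≤ Finset.univ.sup' hne fun σ => m σ y := fun y => by
    refine le_trans ?_ (Finset.le_sup' (fun σ => m σ y) (Finset.mem_univ ∅))
    simp [m]
  refine ⟨fun y => Finset.univ.sup' hne fun σ => m σ y,
    Continuous.finset_sup'_apply _ fun σ _ => hm σ, h0, ?_, ?_⟩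
  · intro y
    by_contra hn
    set σ := Finset.univ.filter fun w => (Finset.univ.sup' hne fun σ => m σ y) < y w with hσ
    have hσne : σ.Nonempty := by
      rw [Finset.nonempty_iff_ne_empty]
      intro h
      rw [h] at hn
      exact hn (by simpa using hv)
    have h1 : m σ y ≤ Finset.univ.sup' hne fun σ => m σ y :=
      Finset.le_sup' (fun σ => m σ y) (Finset.mem_univ σ)
    simp only [m, dif_pos (show σ.Nonempty ∧ insert v σ ∉ K from ⟨hσne, hn⟩)] at h1
    obtain ⟨w, hw, hwe⟩ := Finset.exists_mem_eq_inf' hσne y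
    rw [hwe] at h1
    have h2 := hw
    rw [hσ, Finset.mem_filter] at h2
    exact absurd h2.2 (not_lt.2 h1)
  · intro y hy
    refine le_antisymm (Finset.sup'_le _ _ fun σ _ => ?_) (h0 y)
    by_cases h : σ.Nonempty ∧ insert v σ ∉ K
    · simp only [m, dif_pos h]
      have : ¬ σ ⊆ Finset.univ.filter fun w => 0 < y w := fun hs =>
        h.2 (hK (Finset.insert_subset_insert v hs) hy)
      obtain ⟨w, hw, hwn⟩ := Finset.not_subset.1 this
      refine (Finset.inf'_le y hw).trans ?_
      simpa using hwn
    · simp [m, dif_neg h]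

/-- The closed star of a vertex is a retract of the ambient space. -/
theorem exists_retraction_star (hK : IsLowerSet K) (hv : {v} ∈ K) :
    ∃ ρ : (V → ℝ) → V → ℝ, Continuous ρ ∧ (∀ y, ρ y ∈ polyhedron K) ∧
      ∀ x ∈ polyhedron K, insert v (Finset.univ.filter fun w => 0 < x w) ∈ K → ρ x = x := by
  obtain ⟨t, ht, ht0, htK, htz⟩ := exists_level hK hv
  let z : (V → ℝ) → V → ℝ := fun y w => if w = v then 0 else max (y w - t y) 0
  have hz : ∀ w, Continuous fun y => z y w := by
    intro w
    by_cases h : w = v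
    · simpa [z, h] using continuous_const
    · simp only [z, h, if_false]
      fun_prop
  have hz0 : ∀ y w, 0 ≤ z y w := by
    intro y w
    simp only [z]
    split_ifs
    exacts [le_rfl, le_max_right _ _]
  let s : (V → ℝ) → ℝ := fun y => ∑ w, z y w
  have hs : Continuous s := continuous_finsetSum _ fun w _ => hz w
  have hM : ∀ y, 0 < max 1 (s y) := fun y => lt_max_of_lt_left one_pos
  refine ⟨fun y w => z y w / max 1 (s y) + if w = v then 1 - s y / max 1 (s y) else 0, ?_, ?_, ?_⟩
  · refine continuous_pi fun w => ((hz w).div (by fun_prop) fun y => (hM y).ne').add ?_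
    by_cases h : w = v
    · simp only [h, if_true]
      exact continuous_const.sub (hs.div (by fun_prop) fun y => (hM y).ne')
    · simpa [h] using continuous_const
  · intro y
    refine ⟨fun w => add_nonneg (div_nonneg (hz0 y w) (hM y).le) ?_, ?_, hK ?_ (htK y)⟩
    · split_ifs
      · exact sub_nonneg.2 ((div_le_one (hM y)).2 (le_max_right _ _))
      · exact le_rfl
    · simp only [Finset.sum_add_distrib, ← Finset.sum_div, Finset.sum_ite_eq', Finset.mem_univ,
        if_true]
      change s y / _ + _ = _
      ring
    · intro w hw
      by_cases h : w = v
      · simp [h]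
      · simp only [Finset.mem_filter, h, if_false, add_zero, Finset.mem_univ, true_and, z] at hw
        have := (div_pos_iff_of_pos_right (hM y)).1 hw
        rw [lt_max_iff] at this
        simp only [lt_self_iff_false, or_false, sub_pos] at this
        simpa [h] using this
  · intro x hx hxv
    have hzx : ∀ w, z x w = x w - if w = v then x v else 0 := by
      intro w
      by_cases h : w = v
      · simp [z, h]
      · simp [z, h, htz x hxv, hx.1 w]
    have hsx : s x = 1 - x v := by
      simp [s, hzx, Finset.sum_sub_distrib, hx.2.1]
    have hM1 : max 1 (s x) = 1 := max_eq_left (by rw [hsx]; linarith [hx.1 v])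
    funext w
    simp only [hM1, div_one]
    simp only [hsx, hzx]
    by_cases h : w = v <;> simp [h]

/-- Over the deletion of `v`, the segments towards `v` can be continuously deformed into the
complex without moving those that already lie in it. -/
theorem exists_push (hK : IsLowerSet K) (hv : {v} ∈ K) :
    ∃ Φ : (V → ℝ) × ℝ → V → ℝ,
      ContinuousOn Φ (polyhedron (deletion K v) ×ˢ Ico 0 1) ∧
      MapsTo Φ (polyhedron (deletion K v) ×ˢ Ico 0 1) (polyhedron K) ∧
      ∀ g ∈ polyhedron (deletion K v), ∀ u ∈ Ico (0 : ℝ) 1, towards v u g ∈ polyhedron K →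
        Φ (g, u) = towards v u g := by
  obtain ⟨τ, hτ, hτ0, hτK, hτz⟩ := exists_level hK hv
  let c : ℝ := Fintype.card V + 1
  have hc : 0 < c := by positivity
  let t : (V → ℝ) × ℝ → ℝ := fun q => min (q.2 / c) (τ q.1)
  have ht : Continuous t := (continuous_snd.div_const c).min (hτ.comp continuous_fst)
  let z : (V → ℝ) × ℝ → V → ℝ := fun q w => max (q.1 w - t q) 0
  have hz : Continuous z := continuous_pi fun w => by fun_prop
  have hz0 : ∀ q w, 0 ≤ z q w := fun q w => le_max_right _ _
  let s : (V → ℝ) × ℝ → ℝ := fun q => ∑ w, z q w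
  have hs : Continuous s := by fun_prop
  have hs0 : ∀ q ∈ polyhedron (deletion K v) ×ˢ Ico (0 : ℝ) 1, 0 < s q := by
    rintro ⟨g, u⟩ ⟨hg, hu⟩
    refine lt_of_le_of_ne (Finset.sum_nonneg fun w _ => hz0 _ w) fun h => ?_
    have h1 : ∀ w, g w ≤ 1 / c := by
      intro w
      have hzw := (Finset.sum_eq_zero_iff_of_nonneg fun w _ => hz0 (g, u) w).1 h.symm w
        (Finset.mem_univ w)
      have h2 : g w - t (g, u) ≤ 0 := max_eq_right_iff.1 hzw
      have h3 : t (g, u) ≤ u / c := min_le_left _ _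
      have h4 : u / c ≤ 1 / c := by gcongr; exact hu.2.le
      linarith
    have h5 : ∑ w, g w ≤ ∑ _w : V, 1 / c := Finset.sum_le_sum fun w _ => h1 w
    rw [hg.2.1] at h5
    simp only [Finset.sum_const, Finset.card_univ, nsmul_eq_mul, mul_one_div, le_div_iff₀ hc] at h5
    simp only [c] at h5
    linarith
  have hr0 : ∀ q : (V → ℝ) × ℝ, 0 ≤ q.2 - c * t q := by
    intro q
    have : t q ≤ q.2 / c := min_le_left _ _
    rw [le_div_iff₀ hc] at this
    linarith
  have ht0 : ∀ q : (V → ℝ) × ℝ, 0 ≤ q.2 → 0 ≤ t q := fun q hq =>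
    le_min (div_nonneg hq hc.le) (hτ0 _)
  refine ⟨fun q => towards v (q.2 - c * t q) fun w => z q w / s q, ?_, ?_, ?_⟩
  · refine continuousOn_pi.2 fun w => ?_
    simp only [towards]
    refine ContinuousOn.add (ContinuousOn.mul (by fun_prop) ?_) ?_
    · exact ContinuousOn.div (by fun_prop) hs.continuousOn fun q hq => (hs0 q hq).ne'
    · by_cases h : w = v
      · simp only [h, if_true]
        fun_prop
      · simpa [h] using continuousOn_const
  · rintro ⟨g, u⟩ hq
    have hsq := hs0 _ hq
    obtain ⟨hg, hu⟩ := hq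
    have htq := ht0 (g, u) hu.1
    have hrq := hr0 (g, u)
    simp only at hrq hsq
    have hr1 : u - c * t (g, u) ≤ 1 := by
      have := mul_nonneg hc.le htq
      linarith [hu.2]
    refine ⟨fun w => ?_, sum_towards ?_, ?_⟩
    · exact add_nonneg (mul_nonneg (sub_nonneg.2 hr1) (div_nonneg (hz0 _ w) hsq.le))
        (by split_ifs; exacts [hrq, le_rfl])
    · rw [← Finset.sum_div]
      exact div_self hsq.ne'
    · have hsupp : ∀ w, w ≠ v ∨ u - c * t (g, u) = 0 →
          0 < towards v (u - c * t (g, u)) (fun w => z (g, u) w / s (g, u)) w →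
          t (g, u) < g w := by
        intro w hw hpos
        have h1 : (if w = v then u - c * t (g, u) else 0) = 0 := by
          rcases hw with hw | hw <;> simp [hw]
        simp only [towards, h1, add_zero] at hpos
        have h2 := pos_of_mul_pos_right hpos (sub_nonneg.2 hr1)
        have h3 := (div_pos_iff_of_pos_right hsq).1 h2
        simpa [z] using h3
      rcases hrq.eq_or_lt with h0 | hpos
      · refine hK ?_ (deletion_subset hg.2.2)
        intro w hw
        simp only [Finset.mem_filter, Finset.mem_univ, true_and] at hw ⊢
        exact htq.trans_lt (hsupp w (Or.inr h0.symm) hw)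
      · have htτ : t (g, u) = τ g := by
          rcases min_choice (u / c) (τ g) with h | h
          · exfalso
            have : t (g, u) = u / c := h
            rw [this, mul_div_cancel₀ _ hc.ne', sub_self] at hpos
            exact lt_irrefl _ hpos
          · exact h
        refine hK ?_ (hτK g)
        intro w hw
        by_cases h : w = v
        · simp [h]
        · simp only [Finset.mem_filter, Finset.mem_univ, true_and] at hw
          have := hsupp w (Or.inl h) hw
          rw [htτ] at this
          simp [this]
  · intro g hg u hu hgu
    have htz : t (g, u) = 0 := by
      rcases hu.1.eq_or_lt with h | h
      · simp [t, ← h, hτ0 g]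
      · have : τ g = 0 := by
          refine hτz g (hK ?_ hgu.2.2)
          intro w hw
          simp only [Finset.mem_insert, Finset.mem_filter, Finset.mem_univ, true_and] at hw ⊢
          have h1 : 0 < 1 - u := sub_pos.2 hu.2
          rcases hw with hw | hw
          · subst hw
            simp only [towards, if_true]
            have := mul_nonneg h1.le (hg.1 w)
            linarith
          · have := mul_pos h1 hw
            simp only [towards]
            split_ifs <;> linarith
        simp only [t, this]
        exact min_eq_right (div_nonneg hu.1 hc.le)
    have hzg : z (g, u) = g := by
      funext w
      simp [z, htz, hg.1 w]
    have hs1 : s (g, u) = 1 := by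
      simp only [s, hzg]
      exact hg.2.1
    simp [htz, hzg, hs1]

/-- A complex with a cone vertex has the extension property in all dimensions. -/
theorem extendsBelow_of_cone (hK : IsLowerSet K) (hv : {v} ∈ K) (hcone : ∀ A ∈ K, insert v A ∈ K)
    (d : ℕ) : ExtendsBelow d (polyhedron K) := by
  intro N Y Q f _ _ _ hQ hf hfK
  obtain ⟨ρ, hρ, hρK, hρx⟩ := exists_retraction_star hK hv
  obtain ⟨F, hF, hFf⟩ := exists_continuous_extension hQ hf
  refine ⟨ρ ∘ F, (hρ.comp hF).continuousOn, fun x _ => hρK _, fun x hx => ?_⟩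
  simp only [Function.comp, hFf hx]
  exact hρx _ (hfK hx) (hcone _ (hfK hx).2.2)

/-- A complex inherits the extension property from the deletion and the link of a vertex. -/
theorem ExtendsBelow.of_deletion_of_link (hK : IsLowerSet K) (hv : {v} ∈ K) {d : ℕ}
    (hD : ExtendsBelow (d + 1) (polyhedron (deletion K v)))
    (hL : ExtendsBelow d (polyhedron (link K v))) : ExtendsBelow (d + 1) (polyhedron K) := by
  intro N Y Q f hY hYd hQY hQ hf hfK
  obtain ⟨F, hF, hFf⟩ := exists_continuous_extension hQ hf
  let u : (Fin N → ℝ) → ℝ := fun x => max 0 (F x v)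
  have hu : Continuous u := by fun_prop
  have hu0 : ∀ x, 0 ≤ u x := fun x => le_max_left _ _
  have huf : ∀ x ∈ Q, f x v = u x := fun x hx => by
    simp only [u, hFf hx]
    exact (max_eq_right ((hfK hx).1 v)).symm
  obtain ⟨P₀, P₁, hP₀, hP₁, hP, hP₀u, hP₁u, hS⟩ :=
    hYd.exists_partition hY hu (show (1 / 3 : ℝ) < 2 / 3 by norm_num)
  have hSc : IsClosed (P₀ ∩ P₁) := hP₀.inter hP₁
  have hP₀Y : P₀ ⊆ Y := hP ▸ subset_union_left
  have hP₁Y : P₁ ⊆ Y := hP ▸ subset_union_right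
  have hu1 : ∀ x ∈ P₀, u x < 1 := fun x hx => (hP₀u x hx).trans (by norm_num)
  have hupos : ∀ x ∈ P₁, 0 < u x := fun x hx => (by norm_num : (0 : ℝ) < 1 / 3).trans (hP₁u x hx)
  -- extend over the partition, staying in the open star of `v`
  obtain ⟨gS, hgS, hgSL, hgSf⟩ := hL N (P₀ ∩ P₁) (Q ∩ (P₀ ∩ P₁)) (awayFrom v ∘ f)
    (hY.of_isClosed_subset hSc (inter_subset_left.trans hP₀Y)) hS inter_subset_right
    (hQ.inter hSc)
    ((continuousOn_awayFrom v).comp (hf.mono inter_subset_left) fun x hx => by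
      simpa only [mem_ofPred_eq, huf x hx.1] using hu1 x hx.2.1)
    (fun x hx => awayFrom_mem_link (hfK hx.1) (by simpa only [huf x hx.1] using hu1 x hx.2.1)
      (by simpa only [huf x hx.1] using hupos x hx.2.2))
  have htow : ∀ {A : Set (Fin N → ℝ)} {h : (Fin N → ℝ) → V → ℝ}, ContinuousOn h A →
      ContinuousOn (fun x => towards v (u x) (h x)) A := by
    intro A h hh
    refine continuousOn_pi.2 fun w => ContinuousOn.add ?_ ?_
    · exact (continuous_const.sub hu).continuousOn.mul (continuousOn_pi.1 hh w)
    · by_cases hw : w = v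
      · simpa [hw] using hu.continuousOn
      · simpa [hw] using continuousOn_const
  obtain ⟨k, hk, hkf, hkS⟩ := exists_continuousOn_glue hQ hSc hf (htow hgS) (by
    intro x hx
    have h1 : f x v < 1 := by simpa only [huf x hx.1] using hu1 x hx.2.1
    simp only [hgSf hx, Function.comp, ← huf x hx.1, towards_awayFrom h1])
  have hkK : MapsTo k (Q ∪ P₀ ∩ P₁) (polyhedron K) := by
    rintro x (hx | hx)
    · rw [hkf hx]
      exact hfK hx
    · rw [hkS hx]
      exact towards_mem hK (hgSL hx) ⟨hu0 x, (hu1 x hx.1).le⟩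
  have hkv : ∀ x ∈ Q ∪ P₀ ∩ P₁, k x v = u x := by
    rintro x (hx | hx)
    · rw [hkf hx, huf x hx]
    · rw [hkS hx]
      simp [towards, apply_eq_zero_of_mem_polyhedron (fun A hA => hA.1) (hgSL hx)]
  have hR : IsClosed (Q ∪ P₀ ∩ P₁) := hQ.union hSc
  -- extend over the part away from `v`
  obtain ⟨g₀, hg₀, hg₀D, hg₀k⟩ := hD N P₀ ((Q ∪ P₀ ∩ P₁) ∩ P₀) (awayFrom v ∘ k)
    (hY.of_isClosed_subset hP₀ hP₀Y) (hYd.mono hP₀Y) inter_subset_right (hR.inter hP₀)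
    ((continuousOn_awayFrom v).comp (hk.mono inter_subset_left) fun x hx => by
      simpa only [mem_ofPred_eq, hkv x hx.1] using hu1 x hx.2)
    (fun x hx => awayFrom_mem_deletion hK (hkK hx.1)
      (by simpa only [hkv x hx.1] using hu1 x hx.2))
  obtain ⟨Φ, hΦ, hΦK, hΦt⟩ := exists_push hK hv
  have hΦ₀ : MapsTo (fun x => (g₀ x, u x)) P₀ (polyhedron (deletion K v) ×ˢ Ico 0 1) :=
    fun x hx => ⟨hg₀D hx, hu0 x, hu1 x hx⟩
  have hk₀ : ∀ x ∈ (Q ∪ P₀ ∩ P₁) ∩ P₀, Φ (g₀ x, u x) = k x := by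
    intro x hx
    have h1 : k x v < 1 := by simpa only [hkv x hx.1] using hu1 x hx.2
    have h2 : towards v (u x) (g₀ x) = k x := by
      rw [hg₀k hx, ← hkv x hx.1]
      exact towards_awayFrom h1
    rw [hΦt _ (hg₀D hx.2) _ ⟨hu0 x, hu1 x hx.2⟩ (h2 ▸ hkK hx.1), h2]
  -- extend over the part near `v`
  obtain ⟨ρ, hρ, hρK, hρx⟩ := exists_retraction_star hK hv
  obtain ⟨k', hk', hk'k⟩ := exists_continuous_extension hR hk
  have hk₁ : ∀ x ∈ (Q ∪ P₀ ∩ P₁) ∩ P₁, ρ (k' x) = k x := by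
    intro x hx
    rw [hk'k hx.1]
    refine hρx _ (hkK hx.1) ?_
    have hmem : v ∈ Finset.univ.filter fun w => 0 < k x w := by
      rw [Finset.mem_filter_univ, hkv x hx.1]
      exact hupos x hx.2
    rw [Finset.insert_eq_of_mem hmem]
    exact (hkK hx.1).2.2
  obtain ⟨g, hg, hgP₀, hgP₁⟩ := exists_continuousOn_glue hP₀ hP₁
    (hΦ.comp (hg₀.prodMk hu.continuousOn) hΦ₀) (hρ.comp hk').continuousOn (fun x hx => by
      exact (hk₀ x ⟨Or.inr hx, hx.1⟩).trans (hk₁ x ⟨Or.inr hx, hx.2⟩).symm)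
  refine ⟨g, hP ▸ hg, ?_, ?_⟩
  · rw [← hP]
    rintro x (hx | hx)
    · rw [hgP₀ hx]
      exact hΦK (hΦ₀ hx)
    · rw [hgP₁ hx]
      exact hρK _
  · intro x hx
    rw [← hkf hx]
    rcases hP.symm ▸ hQY hx with h | h
    · exact (hgP₀ h).trans (hk₀ x ⟨Or.inl hx, h⟩)
    · exact (hgP₁ h).trans (hk₁ x ⟨Or.inl hx, h⟩)

end Polyhedron

section Board

variable {m n : ℕ}

/-- The multiple chessboard complex of the squares in `B`, with row capacities `k` and column
capacities one. -/
def boardComplex (B : Set (Fin m × Fin n)) (k : Fin n → ℕ) : Set (Finset (Fin m × Fin n)) :=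
  {A | ↑A ⊆ B ∧ IsFace m n k (fun _ => 1) A}

variable {B : Set (Fin m × Fin n)} {k : Fin n → ℕ}

theorem isLowerSet_boardComplex : IsLowerSet (boardComplex B k) := fun _ _ hs hA =>
  ⟨(Finset.coe_subset.2 hs).trans hA.1,
    fun i => (Finset.card_le_card (Finset.filter_subset_filter _ hs)).trans (hA.2.1 i),
    fun j => (Finset.card_le_card (Finset.filter_subset_filter _ hs)).trans (hA.2.2 j)⟩

theorem realization_eq_polyhedron :
    Realization m n k (fun _ => 1) = polyhedron (boardComplex univ k) := by
  ext f
  constructor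
  · rintro ⟨h0, h1, h⟩
    exact ⟨fun v => (h0 v).1, h1, subset_univ _, h⟩
  · rintro ⟨h0, h1, -, h⟩
    refine ⟨fun v => ⟨h0 v, ?_⟩, h1, h⟩
    rw [← h1]
    exact Finset.single_le_sum (fun w _ => h0 w) (Finset.mem_univ v)

theorem insert_mem_boardComplex_iff {c : Fin m} {r : Fin n} {A : Finset (Fin m × Fin n)}
    (hA : (c, r) ∉ A) :
    insert (c, r) A ∈ boardComplex B k ↔ (c, r) ∈ B ∧ 1 ≤ k r ∧
      A ∈ boardComplex {v | v ∈ B ∧ v.1 ≠ c} (Function.update k r (k r - 1)) := by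
  have hrow : ∀ i, ((insert (c, r) A).filter fun v => v.2 = i).card =
      (A.filter fun v => v.2 = i).card + if r = i then 1 else 0 := by
    intro i
    rw [Finset.filter_insert]
    split_ifs with h
    · exact Finset.card_insert_of_notMem (by simp [hA])
    · rfl
  have hcol : ∀ j, ((insert (c, r) A).filter fun v => v.1 = j).card =
      (A.filter fun v => v.1 = j).card + if c = j then 1 else 0 := by
    intro j
    rw [Finset.filter_insert]
    split_ifs with h
    · exact Finset.card_insert_of_notMem (by simp [hA])
    · rfl
  simp only [boardComplex, IsFace, mem_ofPred_eq, hrow, hcol, Finset.coe_insert, insert_subset_iff]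
  constructor
  · rintro ⟨⟨hv, hAB⟩, hr, hc⟩
    have hr1 := hr r
    simp only [if_true] at hr1
    refine ⟨hv, by omega, fun w hw => ⟨hAB hw, ?_⟩, fun i => ?_, fun j => ?_⟩
    · intro hwc
      have := hc c
      simp only [if_true, add_le_iff_nonpos_left, nonpos_iff_eq_zero, Finset.card_eq_zero,
        Finset.filter_eq_empty_iff] at this
      exact this hw hwc
    · by_cases h : i = r
      · subst h
        rw [Function.update_self]
        omega
      · rw [Function.update_of_ne h]
        exact (Nat.le_add_right _ _).trans (hr i)
    · exact (Nat.le_add_right _ _).trans (hc j)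
  · rintro ⟨hv, hk, hAB, hr, hc⟩
    refine ⟨⟨hv, fun w hw => (hAB hw).1⟩, fun i => ?_, fun j => ?_⟩
    · have := hr i
      by_cases h : r = i
      · subst h
        rw [Function.update_self] at this
        simp only [if_true]
        omega
      · rw [Function.update_of_ne (Ne.symm h)] at this
        simpa [h] using this
    · by_cases h : c = j
      · subst h
        have : (A.filter fun v => v.1 = c) = ∅ :=
          Finset.filter_eq_empty_iff.2 fun w hw => (hAB hw).2
        simp [this]
      · simpa [h] using hc j

theorem deletion_boardComplex (v : Fin m × Fin n) :
    deletion (boardComplex B k) v = boardComplex (B \ {v}) k := by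
  ext A
  have h : (A : Set (Fin m × Fin n)) ⊆ B \ {v} ↔ (A : Set (Fin m × Fin n)) ⊆ B ∧ v ∉ A :=
    ⟨fun h => ⟨fun w hw => (h hw).1, fun hv => (h hv).2 rfl⟩,
      fun h w hw => ⟨h.1 hw, fun hwv => h.2 (by
        rw [mem_singleton_iff] at hwv
        exact hwv ▸ hw)⟩⟩
  simp only [deletion, boardComplex, mem_ofPred_eq, h]
  tauto

theorem link_boardComplex {c : Fin m} {r : Fin n} (hB : (c, r) ∈ B) (hk : 1 ≤ k r) :
    link (boardComplex B k) (c, r) =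
      boardComplex {v | v ∈ B ∧ v.1 ≠ c} (Function.update k r (k r - 1)) := by
  ext A
  constructor
  · rintro ⟨hA, h⟩
    exact ((insert_mem_boardComplex_iff hA).1 h).2.2
  · intro h
    have hA : (c, r) ∉ A := fun hA => (h.1 hA).2 rfl
    exact ⟨hA, (insert_mem_boardComplex_iff hA).2 ⟨hB, hk, h⟩⟩

theorem singleton_mem_boardComplex {c : Fin m} {r : Fin n} (hB : (c, r) ∈ B) (hk : 1 ≤ k r) :
    {(c, r)} ∈ boardComplex B k := by
  have := (insert_mem_boardComplex_iff (A := ∅) (B := B) (k := k) (c := c) (r := r) (by simp)).2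
    ⟨hB, hk, by simp [boardComplex, IsFace]⟩
  simpa using this

/-- Squares in rows of capacity zero play no role. -/
theorem boardComplex_congr {B' : Set (Fin m × Fin n)}
    (h : ∀ v : Fin m × Fin n, k v.2 ≠ 0 → (v ∈ B ↔ v ∈ B')) :
    boardComplex B k = boardComplex B' k := by
  have key : ∀ {B B' : Set (Fin m × Fin n)}, (∀ v : Fin m × Fin n, k v.2 ≠ 0 → v ∈ B → v ∈ B') →
      boardComplex B k ⊆ boardComplex B' k := by
    rintro B B' h A ⟨hAB, hA⟩
    refine ⟨fun v hv => h v ?_ (hAB hv), hA⟩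
    have : 0 < (A.filter fun w => w.2 = v.2).card :=
      Finset.card_pos.2 ⟨v, Finset.mem_filter.2 ⟨hv, rfl⟩⟩
    exact (this.trans_le (hA.1 v.2)).ne'
  exact Subset.antisymm (key fun v hv => (h v hv).1) (key fun v hv => (h v hv).2)

/-- The extension property of a board follows from those obtained by removing a square, and by
placing a rook on it. -/
theorem ExtendsBelow.boardComplex_of_square {c : Fin m} {r : Fin n} (hB : (c, r) ∈ B)
    (hk : 1 ≤ k r) {d : ℕ} (hD : ExtendsBelow (d + 1) (polyhedron (boardComplex (B \ {(c, r)}) k)))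
    (hL : ExtendsBelow d (polyhedron
      (boardComplex {v | v ∈ B ∧ v.1 ≠ c} (Function.update k r (k r - 1))))) :
    ExtendsBelow (d + 1) (polyhedron (boardComplex B k)) :=
  .of_deletion_of_link isLowerSet_boardComplex (singleton_mem_boardComplex hB hk)
    (by rwa [deletion_boardComplex]) (by rwa [link_boardComplex hB hk])

/-- A board on which a square of a row of positive capacity shares neither row nor column with
another usable square is a cone. -/
theorem extendsBelow_boardComplex_of_isolated {c : Fin m} {r : Fin n} (hB : (c, r) ∈ B)
    (hk : 1 ≤ k r) (h : ∀ v ∈ B, v.1 = c ∨ v.2 = r → v = (c, r)) (d : ℕ) :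
    ExtendsBelow d (polyhedron (boardComplex B k)) := by
  refine extendsBelow_of_cone isLowerSet_boardComplex (singleton_mem_boardComplex hB hk) ?_ d
  intro A hA
  by_cases hv : (c, r) ∈ A
  · rwa [Finset.insert_eq_of_mem hv]
  · have hne : ∀ w ∈ A, w.1 ≠ c ∧ w.2 ≠ r := fun w hw =>
      ⟨fun e => hv (h w (hA.1 hw) (Or.inl e) ▸ hw), fun e => hv (h w (hA.1 hw) (Or.inr e) ▸ hw)⟩
    refine (insert_mem_boardComplex_iff hv).2
      ⟨hB, hk, fun w hw => ⟨hA.1 hw, (hne w hw).1⟩, fun i => ?_, hA.2.2⟩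
    by_cases hi : i = r
    · subst hi
      rw [Finset.filter_eq_empty_iff.2 fun w hw => (hne w hw).2]
      simp
    · rw [Function.update_of_ne hi]
      exact hA.2.1 i

theorem sum_update_pred {r : Fin n} (hk : 1 ≤ k r) :
    ∑ i, Function.update k r (k r - 1) i + 1 = ∑ i, k i := by
  rw [Finset.sum_update_of_mem (Finset.mem_univ r), ← Finset.add_sum_erase _ _ (Finset.mem_univ r),
    Finset.sdiff_singleton_eq_erase]
  omega

/-- The number of rows of positive capacity. -/
def numRows (k : Fin n → ℕ) : ℕ := (Finset.univ.filter fun i => k i ≠ 0).card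

theorem numRows_update_pred_le (r : Fin n) :
    numRows (Function.update k r (k r - 1)) ≤ numRows k := by
  refine Finset.card_le_card fun i hi => ?_
  simp only [Finset.mem_filter, Finset.mem_univ, true_and] at hi ⊢
  by_cases h : i = r
  · subst h
    rw [Function.update_self] at hi
    omega
  · rwa [Function.update_of_ne h] at hi

theorem numRows_update_pred_of_eq_one {r : Fin n} (hk : k r = 1) :
    numRows (Function.update k r (k r - 1)) + 1 = numRows k := by
  have h : (Finset.univ.filter fun i => Function.update k r (k r - 1) i ≠ 0) =
      (Finset.univ.filter fun i => k i ≠ 0).erase r := by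
    ext i
    by_cases h : i = r
    · subst h
      simp [hk]
    · simp [h]
  rw [numRows, numRows, h]
  exact Finset.card_erase_add_one (by simp [hk])

/-- The board in which the column `c` meets only the row `r`, and the row `r` meets, apart from
`c`, only the columns in `A`. -/
theorem extendsBelow_of_private_column {s : ℕ}
    (ih : ∀ (C : Finset (Fin m)) (k : Fin n → ℕ), ∑ i, k i < s →
      ∑ i, k i + numRows k ≤ C.card + 1 →
      ExtendsBelow (∑ i, k i) (polyhedron (boardComplex {v | v.1 ∈ C} k)))
    (A : Finset (Fin m)) : ∀ (C : Finset (Fin m)) (c : Fin m) (r : Fin n) (k : Fin n → ℕ),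
      A ⊆ C → c ∉ C → 1 ≤ k r → ∑ i, k i ≤ s → ∑ i, k i + numRows k ≤ C.card + 2 →
      ExtendsBelow (∑ i, k i) (polyhedron (boardComplex
        {v | v.1 ∈ C ∧ v.2 ≠ r ∨ v.1 ∈ A ∧ v.2 = r ∨ v = (c, r)} k)) := by
  induction A using Finset.induction_on with
  | empty =>
    intro C c r k _ hc hk _ _
    refine extendsBelow_boardComplex_of_isolated (c := c) (r := r) (by simp) hk ?_ _
    rintro v (⟨h1, h2⟩ | ⟨h1, -⟩ | h) h'
    · rcases h' with h' | h'
      · exact absurd (h' ▸ h1) hc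
      · exact absurd h' h2
    · simp at h1
    · exact h
  | insert j A hj hA =>
    intro C c r k hAC hc hk hs hcard
    have hjC : j ∈ C := hAC (Finset.mem_insert_self j A)
    have hjc : j ≠ c := fun h => hc (h ▸ hjC)
    have hsum := sum_update_pred hk
    have hCj : (C.erase j).card + 1 = C.card := Finset.card_erase_add_one hjC
    rw [← hsum]
    refine ExtendsBelow.boardComplex_of_square (c := j) (r := r) (by simp) hk ?_ ?_
    · rw [hsum]
      convert hA C c r k ((Finset.subset_insert _ _).trans hAC) hc hk hs hcard using 3
      ext ⟨a, b⟩
      simp only [mem_sdiff, mem_ofPred_eq, mem_singleton_iff, Finset.mem_insert, Prod.mk.injEq]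
      grind
    · by_cases hk1 : k r = 1
      · have hnum := numRows_update_pred_of_eq_one hk1
        convert ih (C.erase j) (Function.update k r (k r - 1)) (by omega) (by omega) using 2
        refine boardComplex_congr ?_
        rintro ⟨a, b⟩ hab
        have hb : b ≠ r := by
          rintro rfl
          simp [hk1] at hab
        simp [hb, and_comm]
      · have hnum := numRows_update_pred_le (k := k) r
        convert hA (C.erase j) c r (Function.update k r (k r - 1))
          (fun a ha => Finset.mem_erase.2 ⟨fun h => hj (h ▸ ha), hAC (Finset.mem_insert_of_mem ha)⟩)
          (fun h => hc (Finset.mem_of_mem_erase h)) (by rw [Function.update_self]; omega)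
          (by omega) (by omega) using 3
        ext ⟨a, b⟩
        simp only [mem_ofPred_eq, Finset.mem_insert, Finset.mem_erase, Prod.mk.injEq]
        grind

/-- A full board with enough columns has the extension property up to the sum of its row
capacities. -/
theorem extendsBelow_boardComplex (C : Finset (Fin m)) (k : Fin n → ℕ)
    (hC : ∑ i, k i + numRows k ≤ C.card + 1) :
    ExtendsBelow (∑ i, k i) (polyhedron (boardComplex {v | v.1 ∈ C} k)) := by
  induction hs : ∑ i, k i using Nat.strong_induction_on generalizing C k with
  | _ s ih =>
  rcases Nat.eq_zero_or_pos s with rfl | hpos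
  · exact extendsBelow_zero _
  obtain ⟨r, -, hr⟩ := Finset.exists_ne_zero_of_sum_ne_zero (hs.trans_ne hpos.ne')
  have hr1 : 1 ≤ k r := Nat.one_le_iff_ne_zero.2 hr
  have hnum : 1 ≤ numRows k := Finset.card_pos.2 ⟨r, by simpa using hr⟩
  obtain ⟨c, hc⟩ : C.Nonempty := Finset.card_pos.1 (by omega)
  have hCc : (C.erase c).card + 1 = C.card := Finset.card_erase_add_one hc
  have main : ∀ T : Finset (Fin n), ExtendsBelow s (polyhedron (boardComplex
      {v | v.1 ∈ C ∧ (v.1 = c → v.2 = r ∨ v.2 ∈ T)} k)) := by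
    intro T
    induction T using Finset.induction_on with
    | empty =>
      have h := extendsBelow_of_private_column (s := s)
        (fun C k hk hC => ih _ hk C k hC rfl) (C.erase c) (C.erase c) c r k
        Subset.rfl (Finset.notMem_erase _ _) hr1 hs.le (by omega)
      rw [hs] at h
      convert h using 3
      ext ⟨a, b⟩
      simp only [mem_ofPred_eq, Finset.mem_erase, Prod.mk.injEq, Finset.notMem_empty, or_false]
      grind
    | insert i T hi hT =>
      by_cases hir : i = r
      · convert hT using 4
        grind
      by_cases hki : k i = 0
      · rwa [boardComplex_congr]
        rintro ⟨a, b⟩ hb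
        have : b ≠ i := by
          rintro rfl
          exact hb hki
        simp [this]
      have hki1 : 1 ≤ k i := Nat.one_le_iff_ne_zero.2 hki
      have hsum := sum_update_pred hki1
      have hnum' := numRows_update_pred_le (k := k) i
      have hs' : s = ∑ l, Function.update k i (k i - 1) l + 1 := by omega
      rw [hs'] at hT ⊢
      refine ExtendsBelow.boardComplex_of_square (c := c) (r := i) (by simp [hc]) hki1 ?_ ?_
      · convert hT using 3
        ext ⟨a, b⟩
        simp only [mem_sdiff, mem_ofPred_eq, mem_singleton_iff, Finset.mem_insert, Prod.mk.injEq]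
        grind
      · convert ih _ (by omega) (C.erase c) (Function.update k i (k i - 1)) (by omega) rfl using 3
        ext ⟨a, b⟩
        simp only [mem_ofPred_eq, Finset.mem_erase]
        grind
  simpa using main Finset.univ

end Board

theorem connectivity_of_uniform_multiple_chessboard_complex
    (p n m : ℕ) (hp : 1 ≤ p) (hn : 1 ≤ n) (hm : (p + 1) * n - 1 ≤ m) :
    CConnected ((p : ℤ) * n - 2) ↥(Realization m n (fun _ => p) fun _ => 1) := by
  have hsum : ∑ _i : Fin n, p = p * n := by simp [mul_comm]
  have h := extendsBelow_boardComplex (m := m) (n := n) Finset.univ (fun _ => p) (by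
    have h1 : numRows (fun _ : Fin n => p) ≤ n :=
      (Finset.card_le_univ _).trans_eq (Fintype.card_fin n)
    rw [hsum, Finset.card_univ, Fintype.card_fin]
    rw [add_mul, one_mul] at hm
    omega)
  rw [hsum] at h
  have hc := h.cConnected (Nat.mul_pos hp hn)
  have huniv : {v : Fin m × Fin n | v.1 ∈ (Finset.univ : Finset (Fin m))} = univ := by
    ext
    simp
  rw [huniv] at hc
  rw [realization_eq_polyhedron]
  simpa using hc
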